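/- arXiv:1012.4891 — 2 statements merged into one kernel-verified Lean document; each statement's English description precedes it below -/
import Mathlib

section
/- Let j and k be integers and let t_x, t_z, t_u be ground terms satisfying the two equations exp(t_x, ⊙ₖ(c)) * g(⊙ⱼ(b)) =_{E₁} exp(t_x, b) * g(t_u) and t_z * g(t_u) =_{E₁} exp(t_z, c) * g(1). Then t_u =_{E₁} ⊙_{jk}(c). -/
/-- Terms built from a countable set of variables, two free constants `b` and
`c`, a constant `1` (`one`), binary symbols `mul` (*), `cmul` (⊛) and `exp`,
and unary symbols `inv` (⁻¹), `iinv` (i) and `g`. -/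
inductive Tm : Type
  | var : ℕ → Tm
  | b : Tm
  | c : Tm
  | one : Tm
  | mul : Tm → Tm → Tm
  | cmul : Tm → Tm → Tm
  | exp : Tm → Tm → Tm
  | inv : Tm → Tm
  | iinv : Tm → Tm
  | g : Tm → Tm

/-- The equational theory E₁: the smallest congruence on terms, closed under
substitution (hence the axioms are stated for arbitrary terms), generated by
associativity and commutativity of `*` and `⊛`, the abelian group axioms for
`(*, ⁻¹, 1)` and `(⊛, i, 1)`, and the exponentiation axioms `exp(X,1) = X`,
`exp(1,Z) = 1`, `exp(X⁻¹,Z) = exp(X,Z)⁻¹`, `exp(g(X),Y) = g(X ⊛ Y)`, and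
`exp(X*Y,Z) = exp(X,Z) * exp(Y,Z)`. -/
inductive E1 : Tm → Tm → Prop
  | mul_assoc (x y z : Tm) : E1 (.mul (.mul x y) z) (.mul x (.mul y z))
  | mul_comm (x y : Tm) : E1 (.mul x y) (.mul y x)
  | cmul_assoc (x y z : Tm) : E1 (.cmul (.cmul x y) z) (.cmul x (.cmul y z))
  | cmul_comm (x y : Tm) : E1 (.cmul x y) (.cmul y x)
  | mul_inv (x : Tm) : E1 (.mul x (.inv x)) .one
  | mul_one (x : Tm) : E1 (.mul x .one) x
  | cmul_iinv (x : Tm) : E1 (.cmul x (.iinv x)) .one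
  | cmul_one (x : Tm) : E1 (.cmul x .one) x
  | exp_one (x : Tm) : E1 (.exp x .one) x
  | one_exp (z : Tm) : E1 (.exp .one z) .one
  | exp_inv (x z : Tm) : E1 (.exp (.inv x) z) (.inv (.exp x z))
  | exp_g (x y : Tm) : E1 (.exp (.g x) y) (.g (.cmul x y))
  | exp_mul (x y z : Tm) : E1 (.exp (.mul x y) z) (.mul (.exp x z) (.exp y z))
  | refl (t : Tm) : E1 t t
  | symm {s t : Tm} : E1 s t → E1 t s
  | trans {s t u : Tm} : E1 s t → E1 t u → E1 s u
  | mul_congr {s t u v : Tm} : E1 s t → E1 u v → E1 (.mul s u) (.mul t v)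
  | cmul_congr {s t u v : Tm} : E1 s t → E1 u v → E1 (.cmul s u) (.cmul t v)
  | exp_congr {s t u v : Tm} : E1 s t → E1 u v → E1 (.exp s u) (.exp t v)
  | inv_congr {s t : Tm} : E1 s t → E1 (.inv s) (.inv t)
  | iinv_congr {s t : Tm} : E1 s t → E1 (.iinv s) (.iinv t)
  | g_congr {s t : Tm} : E1 s t → E1 (.g s) (.g t)

/-- `u ⊛ u ⊛ ⋯ ⊛ u` (`n` factors); the empty product is `1`. -/
def cpow (u : Tm) : ℕ → Tm
  | 0 => .one
  | 1 => u
  | n + 2 => .cmul u (cpow u (n + 1))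

/-- `⊙ₙ(u)`: the term `u ⊛ ⋯ ⊛ u` (`n` factors) if `n > 0`, the term `1` if
`n = 0`, and `i(u) ⊛ ⋯ ⊛ i(u)` (`|n|` factors) if `n < 0`. -/
def odot (n : ℤ) (u : Tm) : Tm :=
  if 0 < n then cpow u n.toNat else cpow (.iinv u) (-n).toNat

/-- A ground term contains no variables. -/
def Tm.Ground : Tm → Prop
  | .var _ => False
  | .b => True
  | .c => True
  | .one => True
  | .mul s t => s.Ground ∧ t.Ground
  | .cmul s t => s.Ground ∧ t.Ground
  | .exp s t => s.Ground ∧ t.Ground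
  | .inv t => t.Ground
  | .iinv t => t.Ground
  | .g t => t.Ground

/-- The equational theory `E1` as a setoid on terms. -/
def E1.setoid : Setoid Tm :=
  ⟨E1, ⟨E1.refl, E1.symm, E1.trans⟩⟩

/-- Terms modulo `E1`. -/
def TermClass : Type := Quotient E1.setoid

namespace TermClass

/-- The class of a term modulo `E1`. -/
def mk (t : Tm) : TermClass := Quotient.mk E1.setoid t

theorem mk_eq_mk {s t : Tm} : mk s = mk t ↔ E1 s t :=
  ⟨fun h => Quotient.exact h, fun h => Quotient.sound (s := E1.setoid) h⟩

/-- Term classes form an abelian group under `⊛`. -/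
instance : CommGroup TermClass where
  mul := Quotient.map₂ Tm.cmul fun _ _ h _ _ h' => E1.cmul_congr h h'
  one := mk .one
  inv := Quotient.map Tm.iinv fun _ _ h => E1.iinv_congr h
  mul_assoc := by
    rintro ⟨x⟩ ⟨y⟩ ⟨z⟩
    exact mk_eq_mk.2 (E1.cmul_assoc x y z)
  one_mul := by
    rintro ⟨x⟩
    exact mk_eq_mk.2 ((E1.cmul_comm _ _).trans (E1.cmul_one x))
  mul_one := by
    rintro ⟨x⟩
    exact mk_eq_mk.2 (E1.cmul_one x)
  inv_mul_cancel := by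
    rintro ⟨x⟩
    exact mk_eq_mk.2 ((E1.cmul_comm _ _).trans (E1.cmul_iinv x))
  mul_comm := by
    rintro ⟨x⟩ ⟨y⟩
    exact mk_eq_mk.2 (E1.cmul_comm x y)

theorem mk_cmul (s t : Tm) : mk (.cmul s t) = mk s * mk t := rfl

theorem mk_one : mk .one = 1 := rfl

theorem mk_iinv (t : Tm) : mk (.iinv t) = (mk t)⁻¹ := rfl

theorem mk_cpow (u : Tm) (n : ℕ) : mk (cpow u n) = mk u ^ n := by
  induction n using cpow.induct with
  | case1 => simp [cpow, mk_one]
  | case2 => simp [cpow]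
  | case3 n ih => rw [cpow, mk_cmul, ih, ← pow_succ']

theorem mk_odot (n : ℤ) (u : Tm) : mk (odot n u) = mk u ^ n := by
  unfold odot
  split_ifs with h
  · rw [mk_cpow, ← zpow_natCast, Int.toNat_of_nonneg h.le]
  · rw [mk_cpow, mk_iinv, ← zpow_natCast, Int.toNat_of_nonneg (by omega), inv_zpow', neg_neg]

end TermClass

open TermClass

/-- The `g`-part of a term in the integral group ring of `(Tm / E1, ⊛)`: it turns `*` into addition,
sends `g(w)` to the basis element `w`, and turns `exp(·, w)` into multiplication by `w`. -/
noncomputable def gPart : Tm → MonoidAlgebra ℤ TermClass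
  | .var _ => 0
  | .b => 0
  | .c => 0
  | .one => 0
  | .mul s t => gPart s + gPart t
  | .cmul s t => gPart s + gPart t
  | .exp s t => gPart s * MonoidAlgebra.of ℤ TermClass (mk t)
  | .inv t => -gPart t
  | .iinv t => -gPart t
  | .g t => MonoidAlgebra.of ℤ TermClass (mk t)

theorem E1.gPart_eq {s t : Tm} (h : E1 s t) : gPart s = gPart t := by
  induction h with
  | exp_congr _ h ih _ => rw [gPart, gPart, ih, mk_eq_mk.2 h]
  | g_congr h => rw [gPart, gPart, mk_eq_mk.2 h]
  | exp_g => rw [gPart, gPart, gPart, mk_cmul, map_mul]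
  | exp_one => rw [gPart, mk_one, map_one, _root_.mul_one]
  | trans _ _ ih ih' => exact ih.trans ih'
  | symm _ ih => exact ih.symm
  | _ => simp only [gPart, *] <;> ring

/-- The exponent of `b` in a term, seen as a homomorphism for both `*` and `⊛`. -/
def bExponent : Tm → ℤ
  | .var _ => 0
  | .b => 1
  | .c => 0
  | .one => 0
  | .mul s t => bExponent s + bExponent t
  | .cmul s t => bExponent s + bExponent t
  | .exp s _ => bExponent s
  | .inv t => -bExponent t
  | .iinv t => -bExponent t
  | .g _ => 0

theorem E1.bExponent_eq {s t : Tm} (h : E1 s t) : bExponent s = bExponent t := by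
  induction h <;> simp only [bExponent, *] <;> ring

/-- The exponent of `b` as a homomorphism on term classes. -/
def bExponentHom : TermClass →* Multiplicative ℤ where
  toFun := Quotient.lift (fun t => Multiplicative.ofAdd (bExponent t))
    fun _ _ h => congrArg _ (E1.bExponent_eq h)
  map_one' := rfl
  map_mul' := by
    rintro ⟨x⟩ ⟨y⟩
    rfl

/-- If `q * x + u = q * y + v` in the group ring of a commutative group, for group elements
`x, y, u, v`, then `u / v` is a power of `x / y`. -/
theorem div_mem_zpowers_of_groupRing_eq {G : Type*} [CommGroup G] {q : MonoidAlgebra ℤ G}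
    {x y u v : G}
    (h : q * MonoidAlgebra.of ℤ G x + MonoidAlgebra.of ℤ G u =
      q * MonoidAlgebra.of ℤ G y + MonoidAlgebra.of ℤ G v) :
    u / v ∈ Subgroup.zpowers (x / y) := by
  let π := QuotientGroup.mk' (Subgroup.zpowers (x / y))
  have hxy : π x = π y :=
    QuotientGroup.eq_iff_div_mem.2 (Subgroup.mem_zpowers _)
  have heq := congrArg (MonoidAlgebra.mapDomainRingHom ℤ π) h
  simp only [map_add, map_mul, MonoidAlgebra.of_apply, MonoidAlgebra.mapDomainRingHom_apply,
    MonoidAlgebra.mapDomain_single, hxy, add_right_inj] at heq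
  exact QuotientGroup.eq_iff_div_mem.1 (MonoidAlgebra.of_injective (R := ℤ) heq)

/-- If ground terms `t_x`, `t_z`, `t_u` satisfy
`exp(t_x, ⊙ₖ(c)) * g(⊙ⱼ(b)) =_{E₁} exp(t_x, b) * g(t_u)` and
`t_z * g(t_u) =_{E₁} exp(t_z, c) * g(1)`, then `t_u =_{E₁} ⊙_{jk}(c)`. -/
theorem multiplication_equations_force_value (j k : ℤ) (tx tz tu : Tm)
    (hx : tx.Ground) (hz : tz.Ground) (hu : tu.Ground)
    (h1 : E1 (.mul (.exp tx (odot k .c)) (.g (odot j .b)))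
             (.mul (.exp tx .b) (.g tu)))
    (h2 : E1 (.mul tz (.g tu)) (.mul (.exp tz .c) (.g .one))) :
    E1 tu (odot (j * k) .c) := by
  have hq := h1.gPart_eq
  have hr := h2.gPart_eq
  simp only [gPart, mk_odot, mk_one] at hq hr
  have hc : mk tu / 1 ∈ Subgroup.zpowers (1 / mk .c) :=
    div_mem_zpowers_of_groupRing_eq (q := gPart tz) (by rwa [map_one, mul_one])
  obtain ⟨m, hm⟩ := hc
  obtain ⟨n, hn⟩ := div_mem_zpowers_of_groupRing_eq hq
  simp only [div_one, one_div] at hm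
  replace hn : (mk .c ^ k / mk .b) ^ n = mk .b ^ j / mk tu := hn
  have hb : bExponentHom (mk .b) = Multiplicative.ofAdd 1 := rfl
  have hc0 : bExponentHom (mk .c) = 1 := rfl
  have hjn := congrArg (fun t => Multiplicative.toAdd (bExponentHom t)) hn
  simp only [← hm, map_zpow, map_div, map_inv, hb, hc0, one_zpow, inv_one, div_one, one_div,
    toAdd_zpow, toAdd_inv, toAdd_ofAdd, smul_eq_mul, mul_one, mul_neg] at hjn
  obtain rfl : n = -j := by omega
  rw [← mk_eq_mk, mk_odot]
  have key : mk tu = mk .b ^ j / (mk .c ^ k / mk .b) ^ (-j) := by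
    rw [hn, div_div_cancel]
  rw [key, div_zpow, zpow_neg, zpow_neg, ← zpow_mul, mul_comm k j]
  simp
end

section
/- Unification over E₁ with free constants is undecidable: under any effective (computable) encoding of finite systems of term equations as natural numbers, the set of finite systems of equations between terms (possibly containing variables) that admit an E₁-unifier is not a computable (decidable) predicate. -/
/-- Application of a substitution (an assignment of terms to variables). -/
def subst (σ : ℕ → Tm) : Tm → Tm
  | .var n => σ n
  | .b => .b
  | .c => .c
  | .one => .one
  | .mul s t => .mul (subst σ s) (subst σ t)
  | .cmul s t => .cmul (subst σ s) (subst σ t)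
  | .exp s t => .exp (subst σ s) (subst σ t)
  | .inv t => .inv (subst σ t)
  | .iinv t => .iinv (subst σ t)
  | .g t => .g (subst σ t)

/-- `σ` is an E₁-unifier of the finite system of equations `L` iff
`σ(sᵢ) =_{E₁} σ(tᵢ)` for every equation `sᵢ =? tᵢ` in `L`. -/
def IsUnifier (σ : ℕ → Tm) (L : List (Tm × Tm)) : Prop :=
  ∀ p ∈ L, E1 (subst σ p.1) (subst σ p.2)

/-- An effective (computable, injective) encoding of terms as naturals. -/
def encTm : Tm → ℕ
  | .var n => Nat.pair 0 n
  | .b => Nat.pair 1 0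
  | .c => Nat.pair 2 0
  | .one => Nat.pair 3 0
  | .mul s t => Nat.pair 4 (Nat.pair (encTm s) (encTm t))
  | .cmul s t => Nat.pair 5 (Nat.pair (encTm s) (encTm t))
  | .exp s t => Nat.pair 6 (Nat.pair (encTm s) (encTm t))
  | .inv t => Nat.pair 7 (encTm t)
  | .iinv t => Nat.pair 8 (encTm t)
  | .g t => Nat.pair 9 (encTm t)

/-- An effective (computable, injective) encoding of finite systems of term
equations as naturals. -/
def encSys : List (Tm × Tm) → ℕ
  | [] => 0
  | (s, t) :: L => Nat.pair (Nat.pair (encTm s) (encTm t)) (encSys L) + 1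

theorem choose_eq_digit (n k u : ℕ) (hu : 2 ^ n < u) :
    n.choose k = (u + 1) ^ n / u ^ k % u := by
  have hlt : ∀ i, n.choose i < u := fun i ↦ (Nat.choose_le_two_pow n i).trans_lt hu
  have hlow : ∀ k, ∑ i ∈ Finset.range k, u ^ i * n.choose i < u ^ k := by
    intro k
    induction k with
    | zero => simp
    | succ k ih =>
      rw [Finset.sum_range_succ, pow_succ]
      have := Nat.mul_le_mul_left (u ^ k) (Nat.succ_le_of_lt (hlt k))
      rw [Nat.mul_succ] at this
      omega
  have hupos : 0 < u := (Nat.zero_le _).trans_lt hu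
  rcases lt_or_ge n k with hk | hk
  · rw [Nat.choose_eq_zero_of_lt hk, Nat.div_eq_of_lt, Nat.zero_mod]
    have := hlow k
    have h2 : (u + 1) ^ n ≤ ∑ i ∈ Finset.range k, u ^ i * n.choose i := by
      rw [add_pow]
      simp only [one_pow, mul_one, Nat.cast_id]
      exact Finset.sum_le_sum_of_subset (Finset.range_mono hk)
    omega
  · obtain ⟨c, hc⟩ : ∃ c, (u + 1) ^ n =
        (∑ i ∈ Finset.range k, u ^ i * n.choose i) + u ^ k * (n.choose k + u * c) := by
      refine ⟨∑ i ∈ Finset.range (n - k), u ^ i * n.choose (k + 1 + i), ?_⟩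
      rw [add_pow]
      simp only [one_pow, mul_one, Nat.cast_id]
      rw [show n + 1 = k + 1 + (n - k) by omega, Finset.sum_range_add, Finset.sum_range_succ,
        add_assoc, mul_add, Finset.mul_sum, Finset.mul_sum]
      congr 2
      exact Finset.sum_congr rfl fun i _ ↦ by ring
    rw [hc, Nat.add_mul_div_left _ _ (pow_pos hupos k), Nat.div_eq_of_lt (hlow k), zero_add,
      Nat.add_mul_mod_self_left, Nat.mod_eq_of_lt (hlt k)]

theorem pow_mul_sub_sq_le_mul_descFactorial (r n : ℕ) (hn : n ≤ r) :
    (r : ℤ) ^ n * (r - n ^ 2) ≤ r * r.descFactorial n := by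
  induction n with
  | zero => simp
  | succ n ih =>
    have h := ih (by omega)
    rw [Nat.descFactorial_succ]
    push_cast [Nat.cast_sub (show n ≤ r by omega)]
    have hr : (0 : ℤ) ≤ (r : ℤ) - n := by
      have : (n : ℤ) ≤ r := by exact_mod_cast (show n ≤ r by omega)
      linarith
    have h1 := mul_le_mul_of_nonneg_left h hr
    have hp : (0 : ℤ) ≤ (r : ℤ) ^ n := by positivity
    have h2 : (0 : ℤ) ≤ (r : ℤ) ^ n * ((n : ℤ) ^ 3 + (n + 1) * r) := by positivity
    rw [pow_succ]
    linarith [h1, h2, show ((r : ℤ) - n) * ((r : ℤ) ^ n * (r - n ^ 2)) -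
      (r : ℤ) ^ n * r * (r - (n + 1) ^ 2) = (r : ℤ) ^ n * ((n : ℤ) ^ 3 + (n + 1) * r) by ring]

theorem factorial_eq_div (n r : ℕ) (hr : n ^ 2 * (n.factorial + 1) < r) :
    n.factorial = r ^ n / r.choose n := by
  have hle : n ≤ r := by nlinarith [n.factorial_pos]
  have hr0 : (0 : ℤ) < r := by exact_mod_cast (Nat.zero_le _).trans_lt hr
  have hD := Nat.descFactorial_eq_factorial_mul_choose r n
  symm
  apply Nat.div_eq_of_lt_le
  · rw [← hD]
    exact Nat.descFactorial_le_pow r n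
  · have h := pow_mul_sub_sq_le_mul_descFactorial r n hle
    have hr' : (n : ℤ) ^ 2 * (n.factorial + 1) < r := by exact_mod_cast hr
    have hf : (0 : ℤ) < n.factorial := by exact_mod_cast n.factorial_pos
    have hp : (0 : ℤ) < (r : ℤ) ^ n := by positivity
    have hD' : (r.descFactorial n : ℤ) = n.factorial * r.choose n := by exact_mod_cast hD
    rw [hD'] at h
    have h3 : (r : ℤ) ^ n * (n.factorial * r) < r ^ n * ((n.factorial + 1) * (r - n ^ 2)) :=
      mul_lt_mul_of_pos_left (by linarith) hp
    have h4 := mul_le_mul_of_nonneg_left h (show (0 : ℤ) ≤ n.factorial + 1 by linarith)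
    have h5 : ((n.factorial : ℤ) * r) * (r : ℤ) ^ n <
        (n.factorial * r) * ((n.factorial + 1) * r.choose n) := by linarith
    have h6 := lt_of_mul_lt_mul_left h5 (by positivity)
    exact_mod_cast h6

/-- The moduli `Q!² / (k + 1) - 1` used to encode bounded families of numbers. -/
def bqModulus (Q k : ℕ) : ℕ := Q.factorial * (Q.factorial / (k + 1)) - 1

theorem succ_mul_bqModulus {Q k : ℕ} (hk : k < Q) :
    (k + 1) * bqModulus Q k = Q.factorial ^ 2 - 1 - k := by
  obtain ⟨c, hc⟩ := Nat.dvd_factorial (Nat.succ_pos k) hk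
  have : Q.factorial / (k + 1) = c := by rw [hc, Nat.mul_div_cancel_left _ (Nat.succ_pos k)]
  rw [bqModulus, this, Nat.mul_sub, sq, Nat.sub_sub, add_comm 1 k, mul_one,
    Nat.mul_left_comm, ← Nat.succ_eq_add_one, ← hc]

theorem factorial_div_succ_pos {Q k : ℕ} (hk : k < Q) : 0 < Q.factorial / (k + 1) :=
  Nat.div_pos (Nat.le_of_dvd Q.factorial_pos (Nat.dvd_factorial (Nat.succ_pos k) hk))
    (Nat.succ_pos k)

theorem bqModulus_add_one {Q k : ℕ} (hk : k < Q) :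
    bqModulus Q k + 1 = Q.factorial * (Q.factorial / (k + 1)) := by
  have := Nat.mul_pos Q.factorial_pos (factorial_div_succ_pos hk)
  rw [bqModulus]
  omega

theorem one_lt_bqModulus {Q k : ℕ} (hk : k < Q) (hQ : 3 ≤ Q) : 1 < bqModulus Q k := by
  have := Nat.le_mul_of_pos_right Q.factorial (factorial_div_succ_pos hk)
  have := Nat.self_le_factorial Q
  rw [bqModulus]
  omega

theorem prod_bqModulus {Q y : ℕ} (hy : y < Q) :
    ∏ k ∈ Finset.range (y + 1), bqModulus Q k = (Q.factorial ^ 2 - 1).choose (y + 1) := by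
  have h := Nat.descFactorial_eq_factorial_mul_choose (Q.factorial ^ 2 - 1) (y + 1)
  rw [Nat.descFactorial_eq_prod_range, ← Finset.prod_range_add_one_eq_factorial (y + 1),
    Finset.prod_congr rfl fun k hk ↦ (succ_mul_bqModulus (Q := Q) (k := k)
      (by have := Finset.mem_range.1 hk; omega)).symm, Finset.prod_mul_distrib] at h
  exact Nat.eq_of_mul_eq_mul_left (Finset.prod_pos fun i _ ↦ Nat.succ_pos i) h

theorem lt_of_prime_dvd_bqModulus {Q k p : ℕ} (hk : k < Q) (hp : p.Prime)
    (h : p ∣ bqModulus Q k) : Q < p := by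
  by_contra! hle
  have h1 : p ∣ bqModulus Q k + 1 :=
    bqModulus_add_one hk ▸ (Nat.dvd_factorial hp.pos hle).mul_right _
  exact hp.one_lt.ne' (Nat.dvd_one.1 ((Nat.dvd_add_right h).1 h1))

theorem modEq_of_dvd_bqModulus {Q k m : ℕ} (hk : k < Q) (hQ : 2 ≤ Q) (h : m ∣ bqModulus Q k) :
    Q.factorial ^ 2 - 1 ≡ k [MOD m] := by
  have h1 : k ≤ Q.factorial ^ 2 - 1 := by
    have := Nat.self_le_factorial Q
    have : Q.factorial + 1 ≤ Q.factorial ^ 2 := by nlinarith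
    omega
  refine ((Nat.modEq_iff_dvd' h1).2 ?_).symm
  rw [← succ_mul_bqModulus hk]
  exact h.mul_left _

theorem coprime_bqModulus {Q k l : ℕ} (hk : k < Q) (hl : l < Q) (hkl : k ≠ l) (hQ : 2 ≤ Q) :
    Nat.Coprime (bqModulus Q k) (bqModulus Q l) := by
  refine Nat.Coprime.symm (Nat.coprime_of_dvd fun p hp h1 h2 ↦ hkl ?_)
  have hQp := lt_of_prime_dvd_bqModulus hk hp h2
  have := (modEq_of_dvd_bqModulus hk hQ h2).symm.trans (modEq_of_dvd_bqModulus hl hQ h1)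
  exact this.eq_of_lt_of_lt (hk.trans hQp) (hl.trans hQp)

theorem exists_le_modEq_of_dvd_choose {p a u : ℕ} (hp : p.Prime) (h : p ∣ a.choose (u + 1)) :
    ∃ j ≤ u, a ≡ j [MOD p] := by
  rcases lt_or_ge a (u + 1) with ha | ha
  · exact ⟨a, by omega, rfl⟩
  have h1 : p ∣ a.descFactorial (u + 1) := by
    rw [Nat.descFactorial_eq_factorial_mul_choose]
    exact h.mul_left _
  rw [Nat.descFactorial_eq_prod_range, hp.prime.dvd_finsetProd_iff] at h1
  obtain ⟨j, hj, hd⟩ := h1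
  have hj := Finset.mem_range.1 hj
  exact ⟨j, by omega, ((Nat.modEq_iff_dvd' (by omega)).2 hd).symm⟩

theorem dvd_choose_of_modEq {m a u j : ℕ} (hm : Nat.Coprime m (u + 1).factorial) (hj : j ≤ u)
    (h : a ≡ j [MOD m]) : m ∣ a.choose (u + 1) := by
  rcases lt_or_ge a (u + 1) with ha | ha
  · simp [Nat.choose_eq_zero_of_lt ha]
  apply hm.dvd_of_dvd_mul_left
  rw [← Nat.descFactorial_eq_factorial_mul_choose, Nat.descFactorial_eq_prod_range]
  exact ((Nat.modEq_iff_dvd' (by omega)).1 h.symm).trans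
    (Finset.dvd_prod_of_mem _ (Finset.mem_range.2 (by omega)))

/-- Elimination of a bounded universal quantifier in front of a Diophantine equation. -/
theorem bounded_forall_iff {β : Type*} [Finite β] (P : ℕ → (β → ℕ) → ℤ)
    (hP : ∀ (m k k' : ℕ) (x x' : β → ℕ), k ≡ k' [MOD m] → (∀ i, x i ≡ x' i [MOD m]) →
      P k x ≡ P k' x' [ZMOD m]) (y : ℕ) (B : ℕ → ℕ)
    (hB : ∀ u k x, k ≤ y → (∀ i, x i ≤ u) → (P k x).natAbs ≤ B u) :
    (∀ k ≤ y, ∃ x, P k x = 0) ↔ ∃ u Q, Q = B u + u + y + 3 ∧ ∃ a : β → ℕ,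
      (∀ i, (Q.factorial ^ 2 - 1).choose (y + 1) ∣ (a i).choose (u + 1)) ∧
      (((Q.factorial ^ 2 - 1).choose (y + 1) : ℕ) : ℤ) ∣ P (Q.factorial ^ 2 - 1) a := by
  constructor
  · intro h
    choose! x hx using h
    obtain ⟨u, hu⟩ : ∃ u, ∀ k ≤ y, ∀ i, x k i ≤ u := by
      obtain ⟨u, hu⟩ := ((Set.finite_Iic y).prod (Set.finite_univ (α := β))).image
        (fun q ↦ x q.1 q.2) |>.bddAbove
      exact ⟨u, fun k hk i ↦ hu ⟨(k, i), ⟨hk, trivial⟩, rfl⟩⟩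
    refine ⟨u, _, rfl, ?_⟩
    set Q := B u + u + y + 3 with hQ
    have hne : ∀ k ∈ Finset.range (y + 1), bqModulus Q k ≠ 0 := by
      intro k hk
      have hk := Finset.mem_range.1 hk
      exact (zero_lt_one.trans (one_lt_bqModulus (by omega) (by omega))).ne'
    have hco : ((Finset.range (y + 1) : Finset ℕ) : Set ℕ).Pairwise
        (Function.onFun Nat.Coprime (bqModulus Q)) := by
      intro k hk l hl hkl
      have hk := Finset.mem_range.1 hk
      have hl := Finset.mem_range.1 hl
      exact coprime_bqModulus (by omega) (by omega) hkl (by omega)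
    have hco' : ((Finset.range (y + 1) : Finset ℕ) : Set ℕ).Pairwise
        (Function.onFun IsCoprime (fun k ↦ (bqModulus Q k : ℤ))) :=
      fun k hk l hl hkl ↦ Nat.isCoprime_iff_coprime.2 (hco hk hl hkl)
    let a : β → ℕ := fun i ↦ Nat.chineseRemainderOfFinset (fun k ↦ x k i) (bqModulus Q) _ hne hco
    have ha : ∀ i, ∀ k ∈ Finset.range (y + 1), a i ≡ x k i [MOD bqModulus Q k] := fun i ↦
      (Nat.chineseRemainderOfFinset (fun k ↦ x k i) (bqModulus Q) _ hne hco).2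
    refine ⟨a, fun i ↦ ?_, ?_⟩
    · rw [← prod_bqModulus (by omega), ← Int.natCast_dvd_natCast, Nat.cast_prod]
      refine Finset.prod_dvd_of_coprime hco' fun k hk ↦ Int.natCast_dvd_natCast.2 ?_
      have hk' := Finset.mem_range.1 hk
      refine dvd_choose_of_modEq ?_ (hu k (by omega) i) (ha i k hk)
      refine Nat.Coprime.symm (Nat.coprime_of_dvd fun p hp h1 h2 ↦ ?_)
      have := lt_of_prime_dvd_bqModulus (by omega) hp h2
      have := hp.dvd_factorial.1 h1
      omega
    · rw [← prod_bqModulus (by omega), Nat.cast_prod]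
      refine Finset.prod_dvd_of_coprime hco' fun k hk ↦ ?_
      have hk' := Finset.mem_range.1 hk
      have := hP (bqModulus Q k) _ k a (x k)
        (modEq_of_dvd_bqModulus (by omega) (by omega) dvd_rfl) (fun i ↦ ha i k hk)
      rw [hx k (by omega)] at this
      exact Int.modEq_zero_iff_dvd.1 this
  · rintro ⟨u, Q, hQ, a, h1, h2⟩ k hk
    have hm : bqModulus Q k ≠ 1 :=
      (one_lt_bqModulus (by omega) (by omega)).ne'
    obtain ⟨p, hp, hpm⟩ := Nat.exists_prime_and_dvd hm
    have hQp := lt_of_prime_dvd_bqModulus (by omega) hp hpm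
    have hpM : p ∣ (Q.factorial ^ 2 - 1).choose (y + 1) := by
      rw [← prod_bqModulus (by omega)]
      exact hpm.trans (Finset.dvd_prod_of_mem _ (Finset.mem_range.2 (by omega)))
    choose x hxu hx using fun i ↦ exists_le_modEq_of_dvd_choose hp (hpM.trans (h1 i))
    refine ⟨x, Int.natAbs_eq_zero.1 (Nat.eq_zero_of_dvd_of_lt (a := p) ?_ ?_)⟩
    · have := hP p _ k a x (modEq_of_dvd_bqModulus (by omega) (by omega) hpm) hx
      exact Int.natCast_dvd.1 (Int.modEq_zero_iff_dvd.1
        (this.symm.trans (Int.modEq_zero_iff_dvd.2 ((Int.natCast_dvd_natCast.2 hpM).trans h2))))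
    · have := hB u k x hk hxu
      omega

namespace Dioph

variable {α : Type}

theorem exists_nat {R : (α → ℕ) → ℕ → Prop}
    (h : Dioph {w : Option α → ℕ | R (w ∘ some) (w none)}) : Dioph {v | ∃ x, R v x} :=
  ex1_dioph h

theorem exists_family {β : Type} {R : (α → ℕ) → (β → ℕ) → Prop}
    (h : Dioph {w : α ⊕ β → ℕ | R (w ∘ Sum.inl) (w ∘ Sum.inr)}) : Dioph {v | ∃ x, R v x} :=
  ex_dioph h

theorem subst_fn {R : (α → ℕ) → ℕ → Prop} {f : (α → ℕ) → ℕ} (df : DiophFn f)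
    (h : Dioph {w : Option α → ℕ | R (w ∘ some) (w none)}) : Dioph {v | R v (f v)} :=
  diophFn_comp1 h df

theorem forall_finite {β : Type} [Finite β] {S : β → Set (α → ℕ)} (h : ∀ i, Dioph (S i)) :
    Dioph {v | ∀ i, v ∈ S i} := by
  have := Fintype.ofFinite β
  refine ext (DiophList.forall (Finset.univ.toList.map S) ?_) fun v ↦ ?_
  · simpa [List.forall_iff_forall_mem] using h
  · simp [List.forall_iff_forall_mem]

theorem exists_finset_eqOn {γ : Type*} (p : Poly γ) :
    ∃ s : Finset γ, ∀ w w' : γ → ℕ, (∀ i ∈ s, w i = w' i) → p w = p w' := by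
  classical
  induction p using Poly.induction with
  | H1 i => exact ⟨{i}, fun w w' h ↦ by simp [h i]⟩
  | H2 n => exact ⟨∅, fun w w' h ↦ by simp⟩
  | H3 f g hf hg | H4 f g hf hg =>
    obtain ⟨s, hs⟩ := hf
    obtain ⟨t, ht⟩ := hg
    refine ⟨s ∪ t, fun w w' h ↦ ?_⟩
    simp [hs w w' fun i hi ↦ h i (by simp [hi]), ht w w' fun i hi ↦ h i (by simp [hi])]

theorem exists_finite_dummies {S : Set (α → ℕ)} (d : Dioph S) :
    ∃ (β : Type) (_ : Finite β) (p : Poly (α ⊕ β)), ∀ v, v ∈ S ↔ ∃ t, p (Sum.elim v t) = 0 := by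
  classical
  obtain ⟨β, p, hp⟩ := d
  obtain ⟨s, hs⟩ := exists_finset_eqOn p
  let s' : Finset β := s.preimage Sum.inr Sum.inr_injective.injOn
  let r : β → Option s' := fun b ↦ if h : b ∈ s' then some ⟨b, h⟩ else none
  refine ⟨Option s', inferInstance, p.map (Sum.map id r), fun v ↦ (hp v).trans ⟨?_, ?_⟩⟩
  · rintro ⟨t, ht⟩
    refine ⟨fun o ↦ o.elim 0 fun b ↦ t b, ?_⟩
    rw [Poly.map_apply, ← ht]
    refine hs _ _ ?_
    rintro (a | b) hb
    · rfl
    · have : b ∈ s' := by simpa [s'] using hb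
      simp [r, this]
  · rintro ⟨t, ht⟩
    refine ⟨t ∘ r, ?_⟩
    rw [← ht, Poly.map_apply]
    congr 1
    ext (a | b) <;> rfl

theorem poly_modEq {γ : Type*} (p : Poly γ) {m : ℕ} {w w' : γ → ℕ}
    (h : ∀ i, w i ≡ w' i [MOD m]) : p w ≡ p w' [ZMOD m] := by
  induction p using Poly.induction with
  | H1 i => simpa using Int.natCast_modEq_iff.2 (h i)
  | H2 n => simp
  | H3 f g hf hg => simpa using hf.sub hg
  | H4 f g hf hg => simpa using hf.mul hg

theorem exists_poly_bound {γ : Type} (p : Poly γ) :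
    ∃ q : (γ → ℕ) → ℕ, DiophFn q ∧ ∀ w w' : γ → ℕ, w ≤ w' → (p w).natAbs ≤ q w' := by
  induction p using Poly.induction with
  | H1 i => exact ⟨_, proj_dioph i, fun w w' h ↦ by simpa using h i⟩
  | H2 n => exact ⟨_, const_dioph n.natAbs, fun w w' h ↦ by simp⟩
  | H3 f g hf hg =>
    obtain ⟨q, hq, hq'⟩ := hf
    obtain ⟨r, hr, hr'⟩ := hg
    refine ⟨_, add_dioph hq hr, fun w w' h ↦ ?_⟩
    exact (Int.natAbs_sub_le _ _).trans (Nat.add_le_add (hq' w w' h) (hr' w w' h))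
  | H4 f g hf hg =>
    obtain ⟨q, hq, hq'⟩ := hf
    obtain ⟨r, hr, hr'⟩ := hg
    refine ⟨_, mul_dioph hq hr, fun w w' h ↦ ?_⟩
    rw [Poly.mul_apply, Int.natAbs_mul]
    exact Nat.mul_le_mul (hq' w w' h) (hr' w w' h)

theorem choose_dioph {f g : (α → ℕ) → ℕ} (df : DiophFn f) (dg : DiophFn g) :
    DiophFn fun v ↦ (f v).choose (g v) := by
  have du : DiophFn fun v ↦ 2 ^ f v + 1 :=
    add_dioph (pow_dioph (const_dioph 2) df) (const_dioph 1)
  have := mod_dioph (div_dioph (pow_dioph (add_dioph du (const_dioph 1)) df) (pow_dioph du dg)) du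
  exact (funext fun v ↦ (choose_eq_digit (f v) (g v) _ (Nat.lt_succ_self _)).symm) ▸ this

theorem factorial_dioph {f : (α → ℕ) → ℕ} (df : DiophFn f) : DiophFn fun v ↦ (f v).factorial := by
  have dr : DiophFn fun v ↦ f v ^ 2 * (f v ^ f v + 1) + 1 :=
    add_dioph (mul_dioph (pow_dioph df (const_dioph 2))
      (add_dioph (pow_dioph df df) (const_dioph 1))) (const_dioph 1)
  have := div_dioph (pow_dioph dr df) (choose_dioph dr df)
  refine (funext fun v ↦ (factorial_eq_div (f v) _ ?_).symm) ▸ this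
  refine Nat.lt_succ_of_le (Nat.mul_le_mul_left _ (Nat.succ_le_succ (Nat.factorial_le_pow _)))

theorem forall_le {R : (α → ℕ) → ℕ → Prop} {f : (α → ℕ) → ℕ} (df : DiophFn f)
    (h : Dioph {w : Option α → ℕ | R (w ∘ some) (w none)}) : Dioph {v | ∀ k ≤ f v, R v k} := by
  obtain ⟨β, _, p, hp⟩ := exists_finite_dummies h
  obtain ⟨q, dq, hq⟩ := exists_poly_bound p
  have key : ∀ v y, (∀ k ≤ y, R v k) ↔ ∃ u Q c, ∃ a : β → ℕ,
      (Q = q (Sum.elim (Option.elim' y v) fun _ ↦ u) + u + y + 3 ∧ c = Q.factorial ^ 2 - 1) ∧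
      (∀ i, c.choose (y + 1) ∣ (a i).choose (u + 1)) ∧
      c.choose (y + 1) ∣ (p (Sum.elim (Option.elim' c v) a)).natAbs := by
    intro v y
    have hR : ∀ k, R v k ↔ ∃ x, p (Sum.elim (Option.elim' k v) x) = 0 := fun k ↦
      hp (Option.elim' k v)
    simp only [hR]
    rw [bounded_forall_iff (fun k x ↦ p (Sum.elim (Option.elim' k v) x)) ?_ y
      (fun u ↦ q (Sum.elim (Option.elim' y v) fun _ ↦ u)) ?_]
    · simp only [Int.natCast_dvd]
      constructor
      · rintro ⟨u, Q, hQ, a, h1, h2⟩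
        exact ⟨u, Q, _, a, ⟨hQ, rfl⟩, h1, h2⟩
      · rintro ⟨u, Q, _, a, ⟨hQ, rfl⟩, h1, h2⟩
        exact ⟨u, Q, hQ, a, h1, h2⟩
    · intro m k k' x x' hk hx
      apply poly_modEq
      rintro ((_ | a) | i)
      exacts [hk, rfl, hx i]
    · intro u k x hk hx
      apply hq
      rintro ((_ | a) | i)
      exacts [hk, le_rfl, hx i]
  refine subst_fn (R := fun v y ↦ ∀ k ≤ y, R v k) df ?_
  simp only [key]
  refine exists_nat (exists_nat (exists_nat (exists_family ?_)))
  let γ := Option (Option (Option (Option α))) ⊕ β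
  have dy : DiophFn fun w : γ → ℕ ↦ w (.inl (some (some (some none)))) := proj_dioph _
  have du : DiophFn fun w : γ → ℕ ↦ w (.inl (some (some none))) := proj_dioph _
  have dQ : DiophFn fun w : γ → ℕ ↦ w (.inl (some none)) := proj_dioph _
  have dc : DiophFn fun w : γ → ℕ ↦ w (.inl none) := proj_dioph _
  have dM := choose_dioph dc (add_dioph dy (const_dioph 1))
  have dB := reindex_diophFn (β := γ) (Sum.elim (Option.elim' (.inl (some (some (some none))))
    fun a ↦ .inl (some (some (some (some a))))) fun _ ↦ .inl (some (some none))) dq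
  refine inter (inter (ext (eq_dioph dQ (add_dioph (add_dioph (add_dioph dB du) dy)
      (const_dioph 3))) ?_) (eq_dioph dc (sub_dioph (pow_dioph (factorial_dioph dQ)
      (const_dioph 2)) (const_dioph 1))))
    (inter (forall_finite fun i ↦ dvd_dioph dM (choose_dioph (proj_dioph (α := γ) (Sum.inr i))
      (add_dioph du (const_dioph 1)))) ?_)
  · intro w
    simp only [Set.mem_ofPred_eq]
    refine Eq.congr rfl (congrArg (fun t ↦ q t + _ + _ + 3) ?_)
    ext ((_ | a) | i) <;> rfl
  · refine ext (dvd_dioph dM (abs_poly_dioph (p.map (Sum.elim (Option.elim' (.inl none)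
      fun a ↦ .inl (some (some (some (some a))))) .inr)))) ?_
    intro w
    simp only [Set.mem_ofPred_eq, Poly.map_apply]
    refine iff_of_eq (congrArg (fun t ↦ _ ∣ (p t).natAbs) ?_)
    ext ((_ | a) | i) <;> rfl

theorem forall_lt {R : (α → ℕ) → ℕ → Prop} {f : (α → ℕ) → ℕ} (df : DiophFn f)
    (h : Dioph {w : Option α → ℕ | R (w ∘ some) (w none)}) : Dioph {v | ∀ k < f v, R v k} := by
  have h1 : Dioph {v | ∀ k ≤ f v, f v ≤ k ∨ R v k} := forall_le df
    (union (le_dioph (reindex_diophFn some df) (proj_dioph none)) h)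
  refine ext h1 fun v ↦ ⟨fun h k hk ↦ (h k hk.le).resolve_left hk.not_ge, fun h k _ ↦ ?_⟩
  exact (le_or_gt (f v) k).imp_right (h k)

end Dioph

namespace Dioph

/-- A binary relation whose pullback along Diophantine functions is always Diophantine. -/
def DiophRel (S : ℕ → ℕ → Prop) : Prop :=
  ∀ {α : Type} {f g : (α → ℕ) → ℕ}, DiophFn f → DiophFn g → Dioph {v | S (f v) (g v)}

variable {α : Type} {f g : (α → ℕ) → ℕ}

theorem lift_some (df : DiophFn f) : DiophFn fun w : Option α → ℕ ↦ f (w ∘ some) :=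
  reindex_diophFn some df

theorem pair_dioph (df : DiophFn f) (dg : DiophFn g) : DiophFn fun v ↦ Nat.pair (f v) (g v) := by
  have df' := lift_some df
  have dg' := lift_some dg
  have dz : DiophFn fun w : Option α → ℕ ↦ w none := proj_dioph none
  refine ext (union (inter (lt_dioph df' dg') (eq_dioph (add_dioph (mul_dioph dg' dg') df') dz))
    (inter (le_dioph dg' df')
      (eq_dioph (add_dioph (add_dioph (mul_dioph df' df') df') dg') dz))) fun w ↦ ?_
  simp only [Set.mem_union, Set.mem_inter_iff, Set.mem_ofPred_eq, Nat.pair]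
  split_ifs with h
  · simp [h, h.not_ge]
  · simp [h, not_lt.1 h]

theorem unpair_fst_dioph (df : DiophFn f) : DiophFn fun v ↦ (f v).unpair.1 := by
  have : Dioph {w : Option α → ℕ | ∃ z, Nat.pair (w none) z = f (w ∘ some)} :=
    exists_nat (eq_dioph (pair_dioph (proj_dioph (some none)) (proj_dioph none))
      (lift_some (lift_some df)))
  refine ext this fun w ↦ ⟨?_, fun h ↦ ⟨(f (w ∘ some)).unpair.2, ?_⟩⟩
  · rintro ⟨z, hz⟩
    simp [← hz]
  · rw [← show _ = w none from h, Nat.pair_unpair]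

theorem unpair_snd_dioph (df : DiophFn f) : DiophFn fun v ↦ (f v).unpair.2 := by
  have : Dioph {w : Option α → ℕ | ∃ z, Nat.pair z (w none) = f (w ∘ some)} :=
    exists_nat (eq_dioph (pair_dioph (proj_dioph none) (proj_dioph (some none)))
      (lift_some (lift_some df)))
  refine ext this fun w ↦ ⟨?_, fun h ↦ ⟨(f (w ∘ some)).unpair.1, ?_⟩⟩
  · rintro ⟨z, hz⟩
    simp [← hz]
  · rw [← show _ = w none from h, Nat.pair_unpair]

theorem beta_dioph (df : DiophFn f) (dg : DiophFn g) : DiophFn fun v ↦ Nat.beta (f v) (g v) :=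
  mod_dioph (unpair_fst_dioph df) (add_dioph (mul_dioph (add_dioph dg (const_dioph 1))
    (unpair_snd_dioph df)) (const_dioph 1))

theorem exists_beta_eq (s : ℕ → ℕ) (n : ℕ) : ∃ m, ∀ i ≤ n, Nat.beta m i = s i := by
  refine ⟨Nat.unbeta ((List.range (n + 1)).map s), fun i hi ↦ ?_⟩
  have := Nat.beta_unbeta_coe ((List.range (n + 1)).map s) ⟨i, by simpa using Nat.lt_succ_of_le hi⟩
  simpa using this

theorem mem_part_rec_iff (f : Part ℕ) (g : ℕ → ℕ → Part ℕ) (n y : ℕ) :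
    (y ∈ (n.rec f fun i IH ↦ IH.bind (g i) : Part ℕ)) ↔
      ∃ m, Nat.beta m 0 ∈ f ∧ (∀ i < n, Nat.beta m (i + 1) ∈ g i (Nat.beta m i)) ∧
        Nat.beta m n = y := by
  have aux : (y ∈ (n.rec f fun i IH ↦ IH.bind (g i) : Part ℕ)) ↔
      ∃ s : ℕ → ℕ, s 0 ∈ f ∧ (∀ i < n, s (i + 1) ∈ g i (s i)) ∧ s n = y := by
    induction n generalizing y with
    | zero => exact ⟨fun h ↦ ⟨fun _ ↦ y, h, by simp, rfl⟩, by rintro ⟨s, h, -, rfl⟩; exact h⟩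
    | succ n ih =>
      simp only [Part.mem_bind_iff, ih]
      constructor
      · rintro ⟨z, ⟨s, h0, h1, rfl⟩, hz⟩
        refine ⟨Function.update s (n + 1) y, by simpa using h0, fun i hi ↦ ?_, by simp⟩
        rcases (Nat.lt_succ_iff_lt_or_eq.1 hi) with hi | rfl
        · rw [Function.update_of_ne (by omega), Function.update_of_ne (by omega)]
          exact h1 i hi
        · rw [Function.update_self, Function.update_of_ne (by omega)]
          exact hz
      · rintro ⟨s, h0, h1, rfl⟩
        exact ⟨s n, ⟨s, h0, fun i hi ↦ h1 i (by omega), rfl⟩, h1 n (by omega)⟩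
  rw [aux]
  constructor
  · rintro ⟨s, h0, h1, rfl⟩
    obtain ⟨m, hm⟩ := exists_beta_eq s n
    refine ⟨m, by rwa [hm 0 (Nat.zero_le n)], fun i hi ↦ ?_, hm n le_rfl⟩
    rw [hm i hi.le, hm (i + 1) hi]
    exact h1 i hi
  · rintro ⟨m, h⟩
    exact ⟨Nat.beta m, h⟩

/-- The graph of a partial recursive function is Diophantine. -/
theorem diophRel_of_partrec {φ : ℕ →. ℕ} (h : Nat.Partrec φ) : DiophRel fun x y ↦ y ∈ φ x := by
  induction h with
  | zero =>
    intro α f g df dg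
    exact ext (eq_dioph dg (const_dioph 0)) fun v ↦ by simp [Part.mem_some_iff, pure, PFun.pure]
  | succ =>
    intro α f g df dg
    exact ext (eq_dioph dg (add_dioph df (const_dioph 1))) fun v ↦ by simp
  | left =>
    intro α f g df dg
    exact ext (eq_dioph dg (unpair_fst_dioph df)) fun v ↦ by simp
  | right =>
    intro α f g df dg
    exact ext (eq_dioph dg (unpair_snd_dioph df)) fun v ↦ by simp
  | @pair φ ψ _ _ hφ hψ =>
    intro α f g df dg
    refine ext (inter (hφ df (unpair_fst_dioph dg)) (hψ df (unpair_snd_dioph dg))) fun v ↦ ?_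
    simp only [Set.mem_inter_iff, Set.mem_ofPred_eq, Seq.seq, Part.map_eq_map,
      Part.mem_bind_iff, Part.mem_map_iff]
    constructor
    · rintro ⟨h1, h2⟩
      exact ⟨_, ⟨_, h1, rfl⟩, _, h2, Nat.pair_unpair _⟩
    · rintro ⟨_, ⟨a, h1, rfl⟩, b, h2, h3⟩
      rw [← h3]
      simpa using ⟨h1, h2⟩
  | @comp φ ψ _ _ hφ hψ =>
    intro α f g df dg
    have : Dioph {v | ∃ z, z ∈ ψ (f v) ∧ g v ∈ φ z} := exists_nat
      (inter (hψ (lift_some df) (proj_dioph none)) (hφ (proj_dioph none) (lift_some dg)))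
    exact ext this fun v ↦ Part.mem_bind_iff.symm
  | @prec φ ψ _ _ hφ hψ =>
    intro α f g df dg
    have : Dioph {v | ∃ m, Nat.beta m 0 ∈ φ (f v).unpair.1 ∧
        (∀ i < (f v).unpair.2, Nat.beta m (i + 1) ∈
          ψ (Nat.pair (f v).unpair.1 (Nat.pair i (Nat.beta m i)))) ∧
        Nat.beta m (f v).unpair.2 = g v} := by
      have df1 := lift_some (unpair_fst_dioph df)
      have df2 := lift_some (unpair_snd_dioph df)
      have dm : DiophFn fun w : Option α → ℕ ↦ w none := proj_dioph none
      have dm' : DiophFn fun w : Option (Option α) → ℕ ↦ w (some none) := proj_dioph _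
      have di : DiophFn fun w : Option (Option α) → ℕ ↦ w none := proj_dioph _
      refine exists_nat (inter (hφ df1 (beta_dioph dm (const_dioph 0))) (inter ?_
        (eq_dioph (beta_dioph dm df2) (lift_some dg))))
      exact forall_lt df2 (hψ (pair_dioph (lift_some df1) (pair_dioph di (beta_dioph dm' di)))
        (beta_dioph dm' (add_dioph di (const_dioph 1))))
    exact ext this fun v ↦ (mem_part_rec_iff (φ (f v).unpair.1)
      (fun i z ↦ ψ (Nat.pair (f v).unpair.1 (Nat.pair i z))) (f v).unpair.2 (g v)).symm
  | @rfind φ _ hφ =>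
    intro α f g df dg
    have : Dioph {v | 0 ∈ φ (Nat.pair (f v) (g v)) ∧
        ∀ i < g v, ∃ z, z + 1 ∈ φ (Nat.pair (f v) i)} := by
      refine inter (hφ (pair_dioph df dg) (const_dioph 0)) ?_
      exact forall_lt dg (exists_nat (hφ (pair_dioph (lift_some (lift_some df))
        (proj_dioph (some none))) (add_dioph (proj_dioph none) (const_dioph 1))))
    refine ext this fun v ↦ ?_
    refine Iff.trans ?_ Nat.mem_rfind.symm
    simp only [Set.mem_ofPred_eq, Part.map_eq_map, Part.mem_map_iff,
      decide_eq_true_eq, decide_eq_false_iff_not, exists_eq_right]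
    refine and_congr_right fun _ ↦ forall₂_congr fun i _ ↦ ⟨?_, ?_⟩
    · rintro ⟨z, hz⟩
      exact ⟨z + 1, hz, z.succ_ne_zero⟩
    · rintro ⟨_ | z, hz, h⟩
      · exact absurd rfl h
      · exact ⟨z, hz⟩

end Dioph

/-- Arithmetic expressions over the integers with variables in `γ`. -/
inductive ArithExpr (γ : Type) : Type
  | var : γ → ArithExpr γ
  | one : ArithExpr γ
  | sub : ArithExpr γ → ArithExpr γ → ArithExpr γ
  | mul : ArithExpr γ → ArithExpr γ → ArithExpr γ

/-- Elementary constraints between integer unknowns: `x i = 1`, `x i + x j = x k` and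
`x i * x j = x k`. -/
inductive Constr (ι : Type) : Type
  | one : ι → Constr ι
  | add : ι → ι → ι → Constr ι
  | mul : ι → ι → ι → Constr ι

namespace Constr

/-- A constraint is satisfied by an assignment of integers to the unknowns. -/
def Holds {ι : Type} (z : ι → ℤ) : Constr ι → Prop
  | one i => z i = 1
  | add i j k => z i + z j = z k
  | mul i j k => z i * z j = z k

/-- Renaming of the unknowns of a constraint. -/
def map {ι κ : Type} (e : ι → κ) : Constr ι → Constr κ
  | one i => one (e i)
  | add i j k => add (e i) (e j) (e k)
  | mul i j k => mul (e i) (e j) (e k)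

theorem holds_map {ι κ : Type} (e : ι → κ) (z : κ → ℤ) (c : Constr ι) :
    (c.map e).Holds z ↔ c.Holds (z ∘ e) := by
  cases c <;> rfl

end Constr

namespace ArithExpr

variable {γ : Type}

/-- A numbering of expressions induced by a numbering of the variables. -/
def code (f : γ → ℕ) : ArithExpr γ → ℕ
  | var a => Nat.pair 0 (f a)
  | one => Nat.pair 1 0
  | sub p q => Nat.pair 2 (Nat.pair (p.code f) (q.code f))
  | mul p q => Nat.pair 3 (Nat.pair (p.code f) (q.code f))

theorem code_injective {f : γ → ℕ} (hf : Function.Injective f) : Function.Injective (code f) := by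
  intro p
  induction p with
  | var a => rintro (b | _ | _ | _) h <;> simp_all [code, hf.eq_iff]
  | one => rintro (b | _ | _ | _) h <;> simp_all [code]
  | sub p q hp hq | mul p q hp hq =>
    rintro (b | _ | ⟨p', q'⟩ | ⟨p', q'⟩) h <;> simp only [code, Nat.pair_eq_pair] at h
    all_goals first | omega | rw [hp h.2.1, hq h.2.2]

/-- The value of an expression. -/
def eval (s : γ → ℤ) : ArithExpr γ → ℤ
  | var a => s a
  | one => 1
  | sub p q => p.eval s - q.eval s
  | mul p q => p.eval s * q.eval s

/-- Constraints saying that the unknown attached to each subexpression is its value. -/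
def constrs : ArithExpr γ → List (Constr (ArithExpr γ))
  | var _ => []
  | one => [.one one]
  | sub p q => .add (sub p q) q p :: (p.constrs ++ q.constrs)
  | mul p q => .mul p q (mul p q) :: (p.constrs ++ q.constrs)

theorem holds_constrs (s : γ → ℤ) (p : ArithExpr γ) :
    ∀ c ∈ p.constrs, c.Holds fun q ↦ q.eval s := by
  induction p with
  | var a => simp [constrs]
  | one => simp [constrs, Constr.Holds, eval]
  | sub p q hp hq =>
    simp only [constrs, List.forall_mem_cons, List.forall_mem_append]
    exact ⟨by simp [Constr.Holds, eval], hp, hq⟩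
  | mul p q hp hq =>
    simp only [constrs, List.forall_mem_cons, List.forall_mem_append]
    exact ⟨by simp [Constr.Holds, eval], hp, hq⟩

theorem eq_eval_of_holds {z : ArithExpr γ → ℤ} {p : ArithExpr γ}
    (h : ∀ c ∈ p.constrs, c.Holds z) : z p = p.eval fun a ↦ z (var a) := by
  induction p with
  | var a => rfl
  | one => exact h (.one one) (by simp [constrs])
  | sub p q hp hq =>
    simp only [constrs, List.forall_mem_cons, List.forall_mem_append] at h
    rw [eval, ← hp h.2.1, ← hq h.2.2, ← h.1, add_sub_cancel_right]
  | mul p q hp hq =>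
    simp only [constrs, List.forall_mem_cons, List.forall_mem_append] at h
    rw [eval, ← hp h.2.1, ← hq h.2.2, ← h.1]

theorem exists_eval_eq_intCast (n : ℤ) : ∃ p : ArithExpr γ, ∀ s, p.eval s = n := by
  induction n with
  | zero => exact ⟨sub one one, fun s ↦ by simp [eval]⟩
  | succ n ih =>
    obtain ⟨p, hp⟩ := ih
    exact ⟨sub p (sub (sub one one) one), fun s ↦ by simp [eval, hp]⟩
  | pred n ih =>
    obtain ⟨p, hp⟩ := ih
    exact ⟨sub p one, fun s ↦ by simp [eval, hp]⟩

/-- The sum of the squares of four variables. -/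
def sumSq (a : Fin 4 → γ) : ArithExpr γ :=
  let sq i := mul (var (a i)) (var (a i))
  let z := sub one one
  sub (sub (sq 0) (sub z (sq 1))) (sub (sub z (sq 2)) (sq 3))

theorem eval_sumSq (a : Fin 4 → γ) (s : γ → ℤ) : (sumSq a).eval s = ∑ i, s (a i) ^ 2 := by
  simp [sumSq, eval, Fin.sum_univ_four]
  ring

theorem exists_eval_eq_poly {β : Type} (p : Poly (Unit ⊕ β)) :
    ∃ E : ArithExpr (Option (β × Fin 4)), ∀ (n : ℕ) (t : β → ℕ) (s : Option (β × Fin 4) → ℤ),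
      s none = n → (∀ a, ∑ i, s (some (a, i)) ^ 2 = t a) →
        E.eval s = p (Sum.elim (fun _ ↦ n) t) := by
  induction p using Poly.induction with
  | H1 a =>
    rcases a with a | a
    · exact ⟨var none, fun n t s h _ ↦ by simp [eval, h]⟩
    · exact ⟨sumSq fun i ↦ some (a, i), fun n t s _ h ↦ by simp [eval_sumSq, h]⟩
  | H2 m =>
    obtain ⟨E, hE⟩ := exists_eval_eq_intCast (γ := Option (β × Fin 4)) m
    exact ⟨E, fun n t s _ _ ↦ by simp [hE]⟩
  | H3 f g hf hg =>
    obtain ⟨F, hF⟩ := hf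
    obtain ⟨G, hG⟩ := hg
    exact ⟨sub F G, fun n t s h h' ↦ by simp [eval, hF n t s h h', hG n t s h h']⟩
  | H4 f g hf hg =>
    obtain ⟨F, hF⟩ := hf
    obtain ⟨G, hG⟩ := hg
    exact ⟨mul F G, fun n t s h h' ↦ by simp [eval, hF n t s h h', hG n t s h h']⟩

end ArithExpr

/-- Membership in a Diophantine set of natural numbers is the solvability over the integers of a
finite system of elementary constraints. -/
theorem Dioph.exists_constr {S : Set (Unit → ℕ)} (hS : Dioph S) :
    ∃ (i₀ : ℕ) (C : List (Constr ℕ)), ∀ n : ℕ, (fun _ ↦ n) ∈ S ↔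
      ∃ z : ℕ → ℤ, z i₀ = n ∧ ∀ c ∈ C, c.Holds z := by
  obtain ⟨β, _, p, hp⟩ := exists_finite_dummies hS
  obtain ⟨E, hE⟩ := ArithExpr.exists_eval_eq_poly p
  obtain ⟨f, hf⟩ := exists_injective_nat (Option (β × Fin 4))
  have : Nonempty (ArithExpr (Option (β × Fin 4))) := ⟨.one⟩
  obtain ⟨e, he⟩ : ∃ e : ArithExpr (Option (β × Fin 4)) → ℕ, Function.Injective e :=
    ⟨_, ArithExpr.code_injective hf⟩
  refine ⟨e (.var none), (.add E E E :: E.constrs).map (Constr.map e), fun n ↦ ?_⟩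
  rw [hp]
  simp only [List.forall_mem_map, Constr.holds_map, List.forall_mem_cons]
  constructor
  · rintro ⟨t, ht⟩
    choose q hq using fun a ↦ Nat.sum_four_squares (t a)
    choose r₁ r₂ r₃ hr using hq
    let s : Option (β × Fin 4) → ℤ := fun o ↦ o.elim n fun x ↦
      ((![q x.1, r₁ x.1, r₂ x.1, r₃ x.1] x.2 : ℕ) : ℤ)
    have hs := hE n t s rfl fun a ↦ by
      simp [s, Fin.sum_univ_four]
      exact_mod_cast hr a
    refine ⟨fun m ↦ (Function.invFun e m).eval s, ?_⟩
    have : ((fun m ↦ (Function.invFun e m).eval s) ∘ e) = fun q ↦ q.eval s :=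
      funext fun q ↦ by simp [Function.leftInverse_invFun he q]
    refine ⟨congrFun this _, ?_⟩
    rw [this]
    refine ⟨?_, E.holds_constrs s⟩
    simp only [Constr.Holds, hs, ht, add_zero]
  · rintro ⟨z, h0, h1, h2⟩
    have hz := ArithExpr.eq_eval_of_holds h2
    let s : Option (β × Fin 4) → ℤ := fun o ↦ z (e (.var o))
    let t : β → ℕ := fun a ↦ (∑ i, s (some (a, i)) ^ 2).toNat
    refine ⟨t, ?_⟩
    have ht : ∀ a, ∑ i, s (some (a, i)) ^ 2 = t a := fun a ↦
      (Int.toNat_of_nonneg (Finset.sum_nonneg fun i _ ↦ sq_nonneg _)).symm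
    rw [← hE n t s h0 ht]
    change _ + _ = _ at h1
    rw [add_eq_left, hz] at h1
    exact h1

/-- The powers of `b`, as terms. -/
def bpow : ℕ → Tm
  | 0 => .one
  | n + 1 => .cmul .b (bpow n)

/-- An equation forcing `y` to be a power of `d`; the variable `p` is auxiliary. -/
def powEq (p : ℕ) (d y : Tm) : Tm × Tm :=
  (.mul (.exp (.var p) d) (.g .one), .mul (.var p) (.g y))

/-- The variable that stands for `b` raised to the `i`th unknown. -/
def bVar (i : ℕ) : Tm := .var (Nat.pair 0 i)

/-- The variable that stands for `c` raised to the `i`th unknown. -/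
def cVar (i : ℕ) : Tm := .var (Nat.pair 1 i)

/-- The equations that express a constraint. -/
def Constr.equations : Constr ℕ → List (Tm × Tm)
  | .one i => [(bVar i, .b)]
  | .add i j k => [(.cmul (bVar i) (bVar j), bVar k)]
  | .mul i j k =>
    [powEq (Nat.pair 2 i) .b (bVar i), powEq (Nat.pair 2 j) .b (bVar j),
      powEq (Nat.pair 2 k) .b (bVar k), powEq (Nat.pair 3 j) .c (cVar j),
      powEq (Nat.pair 4 j) (.cmul .b .c) (.cmul (bVar j) (cVar j)),
      powEq (Nat.pair 5 (Nat.pair i j)) (.cmul (bVar i) .c) (.cmul (bVar k) (cVar j))]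

section Model

open AddMonoidAlgebra

theorem exists_equiv_addMonoidAlgebra :
    ∃ ψ : ℤ × ℤ ≃ AddMonoidAlgebra ℤ (ℤ × ℤ), ψ 0 = 0 := by
  have : Infinite (AddMonoidAlgebra ℤ (ℤ × ℤ)) :=
    .of_injective (fun a ↦ single a (1 : ℤ)) (single_left_injective one_ne_zero)
  have : Countable (AddMonoidAlgebra ℤ (ℤ × ℤ)) :=
    AddMonoidAlgebra.coeff_injective.countable
  obtain ⟨e⟩ := nonempty_equiv_of_countable (α := ℤ × ℤ) (β := AddMonoidAlgebra ℤ (ℤ × ℤ))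
  exact ⟨e.trans (Equiv.swap (e 0) 0), by simp⟩

/-- The interpretation of terms (variables being sent to `0`) in `ℤ × ℤ`, where `⊛` is the
addition and `*` is the addition of the group ring, transported along a bijection. -/
noncomputable def interp (ψ : ℤ × ℤ ≃ AddMonoidAlgebra ℤ (ℤ × ℤ)) : Tm → ℤ × ℤ
  | .var _ => 0
  | .b => (1, 0)
  | .c => (0, 1)
  | .one => 0
  | .mul s t => ψ.symm (ψ (interp ψ s) + ψ (interp ψ t))
  | .cmul s t => interp ψ s + interp ψ t
  | .exp s t => ψ.symm (ψ (interp ψ s) * single (interp ψ t) 1)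
  | .inv t => ψ.symm (-ψ (interp ψ t))
  | .iinv t => -interp ψ t
  | .g t => ψ.symm (single (interp ψ t) 1)

variable {ψ : ℤ × ℤ ≃ AddMonoidAlgebra ℤ (ℤ × ℤ)}

theorem E1.interp_eq (hψ : ψ 0 = 0) {s t : Tm} (h : E1 s t) : interp ψ s = interp ψ t := by
  have hψ' : ψ.symm 0 = 0 := by rw [← hψ, ψ.symm_apply_apply]
  induction h with
  | mul_assoc | cmul_assoc => simp [interp, add_assoc]
  | mul_comm | cmul_comm => simp [interp, add_comm]
  | mul_inv | mul_one | cmul_iinv | cmul_one => simp [interp, hψ, hψ']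
  | exp_one => simp [interp, ← one_def]
  | one_exp => simp [interp, hψ, hψ']
  | exp_inv => simp [interp]
  | exp_g => simp [interp, single_mul_single]
  | exp_mul => simp [interp, add_mul]
  | refl => rfl
  | symm _ ih => exact ih.symm
  | trans _ _ ih ih' => exact ih.trans ih'
  | mul_congr _ _ ih ih' | cmul_congr _ _ ih ih' | exp_congr _ _ ih ih' => simp [interp, ih, ih']
  | inv_congr _ ih | iinv_congr _ ih | g_congr _ ih => simp [interp, ih]

theorem AddMonoidAlgebra.exists_zsmul_eq_of_mul_single_add_one {G : Type*} [AddCommGroup G]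
    {P : AddMonoidAlgebra ℤ G} {d y : G} (h : P * single d 1 + 1 = P + single y 1) :
    ∃ m : ℤ, m • d = y := by
  let π := QuotientAddGroup.mk' (AddSubgroup.zmultiples d)
  have hd : π d = 0 := (QuotientAddGroup.eq_zero_iff d).2 (AddSubgroup.mem_zmultiples d)
  have := congrArg (mapDomainRingHom ℤ π) h
  simp only [map_add, map_mul, map_one, mapDomainRingHom_apply, mapDomain_single, hd] at this
  rw [← one_def, mul_one, add_right_inj, one_def, single_left_inj one_ne_zero] at this
  exact (QuotientAddGroup.eq_zero_iff y).1 this.symm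

theorem exists_zsmul_eq_of_powEq (hψ : ψ 0 = 0) {σ : ℕ → Tm} {p : ℕ} {d y : Tm}
    (h : E1 (subst σ (powEq p d y).1) (subst σ (powEq p d y).2)) :
    ∃ m : ℤ, m • interp ψ (subst σ d) = interp ψ (subst σ y) := by
  have := ψ.symm.injective (h.interp_eq hψ)
  simp only [interp, subst, Equiv.apply_symm_apply] at this
  rw [← one_def] at this
  exact exists_zsmul_eq_of_mul_single_add_one this

theorem Constr.holds_of_isUnifier (hψ : ψ 0 = 0) {σ : ℕ → Tm} {c : Constr ℕ}
    (h : IsUnifier σ c.equations) : c.Holds fun i ↦ (interp ψ (subst σ (bVar i))).1 := by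
  cases c with
  | one i =>
    simp only [IsUnifier, equations, List.forall_mem_singleton] at h
    exact congrArg Prod.fst (h.interp_eq hψ)
  | add i j k =>
    simp only [IsUnifier, equations, List.forall_mem_singleton] at h
    exact congrArg Prod.fst (h.interp_eq hψ)
  | mul i j k =>
    simp only [IsUnifier, equations, List.forall_mem_cons] at h
    obtain ⟨h1, h2, h3, h4, h5, h6, -⟩ := h
    obtain ⟨m1, h1⟩ := exists_zsmul_eq_of_powEq hψ h1
    obtain ⟨m2, h2⟩ := exists_zsmul_eq_of_powEq hψ h2
    obtain ⟨m3, h3⟩ := exists_zsmul_eq_of_powEq hψ h3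
    obtain ⟨m4, h4⟩ := exists_zsmul_eq_of_powEq hψ h4
    obtain ⟨m5, h5⟩ := exists_zsmul_eq_of_powEq hψ h5
    obtain ⟨m6, h6⟩ := exists_zsmul_eq_of_powEq hψ h6
    simp only [subst, interp, Prod.ext_iff, Prod.fst_add, Prod.snd_add, Prod.smul_mk, Prod.smul_fst,
      Prod.smul_snd, smul_eq_mul] at h1 h2 h3 h4 h5 h6
    simp only [Holds]
    grind

end Model

section Quotient

/-- Terms up to the theory `E₁`. -/
def E1Quot : Type := Quot E1

namespace E1Quot

/-- The class of a term. -/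
def mk (t : Tm) : E1Quot := Quot.mk E1 t

theorem mk_eq_mk {s t : Tm} : mk s = mk t ↔ E1 s t :=
  Quot.eq.trans (Equivalence.eqvGen_iff ⟨.refl, .symm, .trans⟩)

theorem mk_out (q : E1Quot) : mk (Quot.out q) = q := Quot.out_eq q

instance : Zero E1Quot := ⟨mk .one⟩

instance : Add E1Quot :=
  ⟨Quot.map₂ .mul (fun _ _ _ h ↦ .mul_congr (.refl _) h) fun _ _ _ h ↦ .mul_congr h (.refl _)⟩

instance : Neg E1Quot := ⟨Quot.map .inv fun _ _ ↦ .inv_congr⟩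

/-- The operation `*`, written additively. -/
instance : AddCommGroup E1Quot where
  add_assoc := by rintro ⟨x⟩ ⟨y⟩ ⟨z⟩; exact mk_eq_mk.2 (.mul_assoc x y z)
  add_comm := by rintro ⟨x⟩ ⟨y⟩; exact mk_eq_mk.2 (.mul_comm x y)
  add_zero := by rintro ⟨x⟩; exact mk_eq_mk.2 (.mul_one x)
  zero_add := by rintro ⟨x⟩; exact mk_eq_mk.2 (.trans (.mul_comm _ x) (.mul_one x))
  neg_add_cancel := by rintro ⟨x⟩; exact mk_eq_mk.2 (.trans (.mul_comm _ x) (.mul_inv x))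
  nsmul := nsmulRec
  zsmul := zsmulRec

/-- The operation `⊛`, written multiplicatively. -/
instance : CommGroup E1Quot where
  mul := Quot.map₂ .cmul (fun _ _ _ h ↦ .cmul_congr (.refl _) h) fun _ _ _ h ↦ .cmul_congr h (.refl _)
  one := mk .one
  inv := Quot.map .iinv fun _ _ ↦ .iinv_congr
  mul_assoc := by rintro ⟨x⟩ ⟨y⟩ ⟨z⟩; exact mk_eq_mk.2 (.cmul_assoc x y z)
  mul_comm := by rintro ⟨x⟩ ⟨y⟩; exact mk_eq_mk.2 (.cmul_comm x y)
  mul_one := by rintro ⟨x⟩; exact mk_eq_mk.2 (.cmul_one x)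
  one_mul := by rintro ⟨x⟩; exact mk_eq_mk.2 (.trans (.cmul_comm _ x) (.cmul_one x))
  inv_mul_cancel := by rintro ⟨x⟩; exact mk_eq_mk.2 (.trans (.cmul_comm _ x) (.cmul_iinv x))

/-- The operation `g` on classes. -/
def g : E1Quot → E1Quot := Quot.map .g fun _ _ ↦ .g_congr

/-- Exponentiation of classes, as an endomorphism for `*`. -/
def expHom (d : E1Quot) : E1Quot →+ E1Quot :=
  .mk' (fun x ↦ Quot.map₂ .exp (fun _ _ _ h ↦ .exp_congr (.refl _) h)
    (fun _ _ _ h ↦ .exp_congr h (.refl _)) x d) (by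
      obtain ⟨d⟩ := d
      rintro ⟨x⟩ ⟨y⟩
      exact mk_eq_mk.2 (.exp_mul x y d))

theorem expHom_g (x d : E1Quot) : expHom d (g x) = g (x * d) := by
  obtain ⟨x⟩ := x
  obtain ⟨d⟩ := d
  exact mk_eq_mk.2 (.exp_g x d)

theorem exists_expHom_add_eq (d : E1Quot) (m : ℤ) : ∃ P, expHom d P + g 1 = P + g (d ^ m) := by
  induction m with
  | zero => exact ⟨0, by simp⟩
  | succ m ih =>
    obtain ⟨P, hP⟩ := ih
    refine ⟨P + g (d ^ (m : ℤ)), ?_⟩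
    rw [map_add, expHom_g, zpow_add_one, ← hP]
    abel
  | pred m ih =>
    obtain ⟨P, hP⟩ := ih
    refine ⟨P - g (d ^ (-m - 1 : ℤ)), ?_⟩
    rw [map_sub, expHom_g, ← zpow_add_one, sub_add_cancel, sub_add_cancel, sub_add_eq_add_sub, hP,
      add_sub_cancel_right]

theorem mk_subst_bpow (σ : ℕ → Tm) (n : ℕ) : mk (subst σ (bpow n)) = mk .b ^ n := by
  induction n with
  | zero => rfl
  | succ n ih =>
    rw [pow_succ', ← ih]
    rfl

/-- The values of all variables that belong to an assignment of integers to the unknowns, `P d m`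
being the value of an auxiliary variable for `d ^ m`. -/
def solution (P : E1Quot → ℤ → E1Quot) (z : ℕ → ℤ) (v : ℕ) : E1Quot :=
  match v.unpair with
  | (0, i) => mk .b ^ z i
  | (1, i) => mk .c ^ z i
  | (2, i) => P (mk .b) (z i)
  | (3, i) => P (mk .c) (z i)
  | (4, i) => P (mk .b * mk .c) (z i)
  | (_, i) => P (mk .b ^ z i.unpair.1 * mk .c) (z i.unpair.2)

end E1Quot

open E1Quot

theorem isUnifier_equations {P : E1Quot → ℤ → E1Quot}
    (hP : ∀ d m, expHom d (P d m) + E1Quot.g 1 = P d m + E1Quot.g (d ^ m)) {z : ℕ → ℤ}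
    {c : Constr ℕ} (hc : c.Holds z) :
    IsUnifier (fun v ↦ Quot.out (solution P z v)) c.equations := by
  set σ : ℕ → Tm := fun v ↦ Quot.out (solution P z v) with hσ
  have hv : ∀ v, mk (σ v) = solution P z v := fun v ↦ mk_out _
  have hb : ∀ i, mk (subst σ (bVar i)) = mk .b ^ z i := fun i ↦ by
    simp [bVar, subst, hv, solution]
  have hw : ∀ i, mk (subst σ (cVar i)) = mk .c ^ z i := fun i ↦ by
    simp [cVar, subst, hv, solution]
  have hmul : ∀ s t, mk (subst σ (.cmul s t)) = mk (subst σ s) * mk (subst σ t) := fun _ _ ↦ rfl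
  have subst_b : subst σ .b = .b := rfl
  have subst_c : subst σ .c = .c := rfl
  have hpow : ∀ {p d y} (m : ℤ), mk (σ p) = P (mk (subst σ d)) m →
      mk (subst σ y) = mk (subst σ d) ^ m →
      E1 (subst σ (powEq p d y).1) (subst σ (powEq p d y).2) := by
    intro p d y m h1 h2
    rw [← mk_eq_mk]
    change expHom (mk (subst σ d)) (mk (σ p)) + E1Quot.g 1 = mk (σ p) + E1Quot.g (mk (subst σ y))
    rw [h1, h2, hP]
  cases c with
  | one i =>
    simp only [IsUnifier, Constr.equations, List.forall_mem_singleton]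
    rw [← mk_eq_mk, hb, show z i = 1 from hc, zpow_one]
    rfl
  | add i j k =>
    simp only [IsUnifier, Constr.equations, List.forall_mem_singleton]
    rw [← mk_eq_mk, hmul, hb, hb, hb, ← show z i + z j = z k from hc, zpow_add]
  | mul i j k =>
    simp only [IsUnifier, Constr.equations, List.forall_mem_cons]
    refine ⟨hpow (z i) ?_ (hb i), hpow (z j) ?_ (hb j), hpow (z k) ?_ (hb k), hpow (z j) ?_ (hw j),
      hpow (z j) ?_ ?_, hpow (z j) ?_ ?_, by simp⟩
    · simp [hv, solution, subst]
    · simp [hv, solution, subst]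
    · simp [hv, solution, subst]
    · simp [hv, solution, subst]
    · simp [hv, solution, hmul, subst_b, subst_c]
    · rw [hmul, hmul, hb, hw, subst_b, subst_c, mul_zpow]
    · simp [hv, solution, hmul, hb, subst_c]
    · rw [hmul, hmul, hb, hb, hw, subst_c, mul_zpow, ← zpow_mul, show z i * z j = z k from hc]

end Quotient

/-- The system of equations attached to a list of constraints whose unknown `i₀` has the
value `n`. -/
def systemOf (i₀ : ℕ) (C : List (Constr ℕ)) (n : ℕ) : List (Tm × Tm) :=
  (bVar i₀, bpow n) :: C.flatMap Constr.equations

theorem exists_isUnifier_systemOf_iff (i₀ : ℕ) (C : List (Constr ℕ)) (n : ℕ) :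
    (∃ σ, IsUnifier σ (systemOf i₀ C n)) ↔ ∃ z : ℕ → ℤ, z i₀ = n ∧ ∀ c ∈ C, c.Holds z := by
  constructor
  · rintro ⟨σ, hσ⟩
    obtain ⟨ψ, hψ⟩ := exists_equiv_addMonoidAlgebra
    refine ⟨fun i ↦ (interp ψ (subst σ (bVar i))).1, ?_, fun c hc ↦ ?_⟩
    · have h := (hσ _ List.mem_cons_self).interp_eq hψ
      refine (congrArg Prod.fst h).trans ?_
      clear h hσ
      induction n with
      | zero => rfl
      | succ n ih =>
        change 1 + _ = _
        rw [ih, Nat.cast_succ, add_comm]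
    · exact Constr.holds_of_isUnifier hψ fun p hp ↦
        hσ p (List.mem_cons_of_mem _ (List.mem_flatMap.2 ⟨c, hc, hp⟩))
  · rintro ⟨z, hz, hC⟩
    choose P hP using E1Quot.exists_expHom_add_eq
    refine ⟨fun v ↦ Quot.out (E1Quot.solution P z v),
      List.forall_mem_cons.2 ⟨?_, fun p hp ↦ ?_⟩⟩
    · rw [← E1Quot.mk_eq_mk, E1Quot.mk_subst_bpow]
      simp [bVar, subst, E1Quot.mk_out, E1Quot.solution, hz]
    · obtain ⟨c, hc, hp⟩ := List.mem_flatMap.1 hp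
      exact isUnifier_equations hP (hC c hc) p hp

theorem primrec_encTm_bpow : Primrec fun n ↦ encTm (bpow n) := by
  have : Primrec fun n : ℕ ↦ (Nat.rec (encTm .one)
      (fun _ t ↦ Nat.pair 5 (Nat.pair (encTm .b) t)) n : ℕ) :=
    Primrec.nat_rec₁ _ (Primrec₂.natPair.comp (Primrec.const _)
      (Primrec₂.natPair.comp (Primrec.const _) Primrec.snd)).to₂
  refine this.of_eq fun n ↦ ?_
  induction n with
  | zero => rfl
  | succ n ih => simp only [ih]; rfl

theorem primrec_encSys_systemOf (i₀ : ℕ) (C : List (Constr ℕ)) :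
    Primrec fun n ↦ encSys (systemOf i₀ C n) :=
  Primrec.succ.comp (Primrec₂.natPair.comp
    (Primrec₂.natPair.comp (Primrec.const _) primrec_encTm_bpow) (Primrec.const _))

/-- The halting problem is the solvability of a system of constraints, in which the program is the
value of one of the unknowns. -/
theorem exists_constr_halting : ∃ (i₀ : ℕ) (C : List (Constr ℕ)), ∀ c : Nat.Partrec.Code,
    (c.eval 0).Dom ↔ ∃ z : ℕ → ℤ, z i₀ = Encodable.encode c ∧ ∀ k ∈ C, k.Holds z := by
  let φ : ℕ →. ℕ := fun n ↦ (Denumerable.ofNat Nat.Partrec.Code n).eval 0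
  have hφ : Nat.Partrec φ := Partrec.nat_iff.1
    (Nat.Partrec.Code.eval_part.comp (Computable.ofNat _) (Computable.const 0))
  have hD : Dioph {v : Unit → ℕ | ∃ y, y ∈ φ (v ())} := Dioph.exists_nat
    (Dioph.diophRel_of_partrec hφ (Dioph.proj_dioph (some ())) (Dioph.proj_dioph none))
  obtain ⟨i₀, C, h⟩ := hD.exists_constr
  refine ⟨i₀, C, fun c ↦ ?_⟩
  rw [← h, Part.dom_iff_mem]
  simp [φ]

/-- Unification over E₁ with free constants is undecidable: no computable
function decides, via the effective encoding `encSys`, whether a finite system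
of equations between terms admits an E₁-unifier. -/
theorem E1_unification_undecidable :
    ¬ ∃ f : ℕ → Bool, Computable f ∧
      ∀ L : List (Tm × Tm),
        (f (encSys L) = true ↔ ∃ σ : ℕ → Tm, IsUnifier σ L) := by
  rintro ⟨f, hf, h⟩
  obtain ⟨i₀, C, hC⟩ := exists_constr_halting
  refine ComputablePred.halting_problem 0 (ComputablePred.computable_iff.2
    ⟨fun c ↦ f (encSys (systemOf i₀ C (Encodable.encode c))), hf.comp
      ((primrec_encSys_systemOf i₀ C).to_comp.comp Computable.encode), funext fun c ↦ ?_⟩)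
  rw [h, exists_isUnifier_systemOf_iff, hC]
end
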